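/- Single-layer form of the observer theorem: let P, d, m, S : ℕ → ℕ be sequences with P_N ≥ 2, d_N ≥ 1, m_N ≥ 1 and S_N ≥ 1 for all N, suppose min(N, S_N) → ∞, and for each N let V_N(U) be the single-layer slice-normal map with parameters (P_N, d_N, m_N). The following are equivalent: (a) for every α > 0 there is a constant C such that for all N ≥ 1 and all unit vectors ψ₁, ψ₂ ∈ ℂ^{P_N d_N} ⊗ ℂ^{m_N}, ∫ |⟨ψ₁, V_N(U)†V_N(U) ψ₂⟩ − ⟨ψ₁, ψ₂⟩|² dμ_N(U) ≤ C · max(N^{−α}, S_N^{−α}); (b) for every k ∈ ℕ, (min(N, S_N))^k / d_N → 0 as N → ∞. -/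

import Mathlib

open MeasureTheory ComplexConjugate
open scoped Matrix

/-- The Borel σ-algebra on the unitary group of complex matrices. -/
noncomputable instance unitaryGroupMeasurableSpace {ι : Type*} [Fintype ι] [DecidableEq ι] :
    MeasurableSpace (Matrix.unitaryGroup ι ℂ) := borel _

instance unitaryGroupBorelSpace {ι : Type*} [Fintype ι] [DecidableEq ι] :
    BorelSpace (Matrix.unitaryGroup ι ℂ) := ⟨rfl⟩

/-- The standard Hermitian inner product `⟨f, g⟩ = ∑ x, conj (f x) * g x`. -/
noncomputable def inn {ι : Type*} [Fintype ι] (f g : ι → ℂ) : ℂ :=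
  ∑ x, conj (f x) * g x

/-- The single-layer slice-normal map
`V(U) = √P (⟨0|_P ⊗ Id_d) U ⊗ Id_m : ℂ^{Pd} ⊗ ℂ^m → ℂ^d ⊗ ℂ^m`, given entrywise by
`(V(U)ψ)(j, y) = √P · ∑ x, U((0, j), x) · ψ(x, y)`. -/
noncomputable def sliceV (P d m : ℕ) (hP : 0 < P)
    (U : Matrix.unitaryGroup (Fin P × Fin d) ℂ)
    (ψ : (Fin P × Fin d) × Fin m → ℂ) : Fin d × Fin m → ℂ :=
  fun jy => (Real.sqrt P : ℂ) *
    ∑ x : Fin P × Fin d,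
      (U : Matrix (Fin P × Fin d) (Fin P × Fin d) ℂ) ((⟨0, hP⟩ : Fin P), jy.1) x * ψ (x, jy.2)

/-- The reduced density matrix of `ψ ∈ ℂ^{Pd} ⊗ ℂ^m` on the out factor `ℂ^m`:
`ψ^out(y, y') = ∑ x, ψ(x, y) · conj (ψ(x, y'))`. -/
noncomputable def outMat (P d m : ℕ) (ψ : (Fin P × Fin d) × Fin m → ℂ) :
    Matrix (Fin m) (Fin m) ℂ :=
  fun y y' => ∑ x : Fin P × Fin d, ψ (x, y) * conj (ψ (x, y'))


section Helpers

variable {ι : Type*} [Fintype ι] [DecidableEq ι]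

lemma compactSpace_unitaryGroup : CompactSpace (Matrix.unitaryGroup ι ℂ) := by
  suffices hmain : IsCompact ((Matrix.unitaryGroup ι ℂ : Submonoid (Matrix ι ι ℂ)) : Set (Matrix ι ι ℂ)) from
    isCompact_iff_compactSpace.mp hmain
  have hc : IsCompact (Set.univ.pi (fun _ : ι => Set.univ.pi
      (fun _ : ι => Metric.closedBall (0 : ℂ) 1)) : Set (ι → ι → ℂ)) :=
    isCompact_univ_pi fun _ => isCompact_univ_pi fun _ => isCompact_closedBall 0 1
  have hclosed : IsClosed {A : Matrix ι ι ℂ | Aᴴ * A = 1} :=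
    isClosed_eq (by fun_prop) continuous_const
  refine IsCompact.of_isClosed_subset (X := Matrix ι ι ℂ) hc ?_ ?_
  · convert hclosed using 1
    ext A
    exact Matrix.mem_unitaryGroup_iff'
  · intro A hA i _ j _
    simpa using entry_norm_bound_of_unitary hA i j

lemma integrable_of_cont (μ : Measure (Matrix.unitaryGroup ι ℂ)) [IsProbabilityMeasure μ]
    {f : Matrix.unitaryGroup ι ℂ → ℝ} (hf : Continuous f) : Integrable f μ := by
  have : CompactSpace (Matrix.unitaryGroup ι ℂ) := compactSpace_unitaryGroup
  exact hf.integrable_of_hasCompactSupport (HasCompactSupport.of_compactSpace f)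

/-- permutation matrices as unitaries -/
noncomputable def permU (σ : Equiv.Perm ι) : Matrix.unitaryGroup ι ℂ :=
  ⟨σ.permMatrix ℂ, by
    rw [Matrix.mem_unitaryGroup_iff', Matrix.star_eq_conjTranspose,
      Matrix.conjTranspose_permMatrix, ← Matrix.permMatrix_mul]
    simp⟩

lemma permU_conj (σ : Equiv.Perm ι) (Y : Matrix ι ι ℂ) (a b : ι) :
    ((permU σ : Matrix ι ι ℂ)ᴴ * Y * (permU σ : Matrix ι ι ℂ)) (σ a) (σ b) = Y a b := by
  have h : ((permU σ : Matrix.unitaryGroup ι ℂ) : Matrix ι ι ℂ) = σ.permMatrix ℂ := rfl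
  rw [h]
  simp [Matrix.mul_apply, Equiv.Perm.permMatrix, PEquiv.toMatrix_apply,
    Equiv.toPEquiv_apply, apply_ite]

lemma exists_perm {a b a' b' : ι} (h : a ≠ b) (h' : a' ≠ b') :
    ∃ σ : Equiv.Perm ι, σ a = a' ∧ σ b = b' := by
  refine ⟨(Equiv.swap a a').trans (Equiv.swap (Equiv.swap a a' b) b'), ?_, ?_⟩
  · have h1 : a' ≠ Equiv.swap a a' b := by
      intro hh
      have : Equiv.swap a a' a = Equiv.swap a a' b := by rw [← hh]; simp
      exact h ((Equiv.swap a a').injective this)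
    simp [Equiv.swap_apply_of_ne_of_ne h1 h']
  · simp

/-- The hypotheses on the random matrix. -/
structure GoodX (X : Matrix.unitaryGroup ι ℂ → Matrix ι ι ℂ) (K : ℝ) : Prop where
  cont : Continuous X
  equiv : ∀ U W : Matrix.unitaryGroup ι ℂ,
    X (U * W) = (W : Matrix ι ι ℂ)ᴴ * X U * (W : Matrix ι ι ℂ)
  herm : ∀ U, (X U)ᴴ = X U
  tr : ∀ U, (X U).trace = 0
  frob : ∀ U, ∑ a, ∑ b, ‖X U a b‖ ^ 2 = K

variable {X : Matrix.unitaryGroup ι ℂ → Matrix ι ι ℂ} {K : ℝ}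
  (μ : Measure (Matrix.unitaryGroup ι ℂ)) [IsProbabilityMeasure μ] [μ.IsMulRightInvariant]

lemma GoodX.contEntry (h : GoodX X K) (a b : ι) : Continuous fun U => X U a b :=
  h.cont.matrix_elem a b

lemma GoodX.diag_cov (h : GoodX X K) (hn : 2 ≤ Fintype.card ι) :
    ∃ c : ℝ, ∀ a b, ∫ U, (X U a a).re * (X U b b).re ∂μ
      = c * ((if a = b then 1 else 0) - 1 / (Fintype.card ι : ℝ)) := by
  set E : ι → ι → ℝ := fun a b => ∫ U, (X U a a).re * (X U b b).re ∂μ with hE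
  have hperm : ∀ (σ : Equiv.Perm ι) a b, E (σ a) (σ b) = E a b := by
    intro σ a b
    have := integral_mul_right_eq_self (μ := μ)
      (fun U => (X U (σ a) (σ a)).re * (X U (σ b) (σ b)).re) (permU σ)
    simp only [h.equiv, permU_conj] at this
    exact this.symm
  have hsum : ∀ a, ∑ b, E a b = 0 := by
    intro a
    simp only [hE]
    rw [← integral_finsetSum]
    · have : ∀ U, ∑ b, (X U a a).re * (X U b b).re = 0 := by
        intro U
        rw [← Finset.mul_sum]
        have := congrArg Complex.re (h.tr U)
        simp only [Matrix.trace, Matrix.diag, Complex.re_sum, Complex.zero_re] at this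
        rw [this, mul_zero]
      simp [this]
    · intro b _
      apply integrable_of_cont
      have := h.contEntry a a
      have := h.contEntry b b
      fun_prop
  obtain ⟨a0, b0, hab⟩ := Fintype.one_lt_card_iff.mp (show 1 < Fintype.card ι by omega)
  have hd : ∀ a, E a a = E a0 a0 := by
    intro a
    have := hperm (Equiv.swap a0 a) a0 a0
    simpa using this
  have ho : ∀ a b, a ≠ b → E a b = E a0 b0 := by
    intro a b hne
    obtain ⟨σ, h1, h2⟩ := exists_perm hab hne
    have := hperm σ a0 b0
    rwa [h1, h2] at this
  have hform : ∀ a b, E a b = (E a0 a0 - E a0 b0) * (if a = b then 1 else 0) + E a0 b0 := by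
    intro a b
    split_ifs with hh
    · subst hh; rw [hd]; ring
    · rw [ho a b hh]; ring
  have h0 := hsum a0
  rw [Finset.sum_congr rfl fun b _ => hform a0 b] at h0
  rw [Finset.sum_add_distrib, ← Finset.mul_sum] at h0
  simp at h0
  have hnpos : (Fintype.card ι : ℝ) ≠ 0 := by positivity
  refine ⟨E a0 a0 - E a0 b0, fun a b => ?_⟩
  rw [show (∫ U, (X U a a).re * (X U b b).re ∂μ) = E a b from rfl, hform a b]
  field_simp
  linarith

lemma GoodX.diag_re (h : GoodX X K) (U) (a : ι) : X U a a = ((X U a a).re : ℂ) := by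
  have := congrFun (congrFun (h.herm U) a) a
  rw [Matrix.conjTranspose_apply] at this
  exact (Complex.conj_eq_iff_re.mp this).symm

lemma GoodX.trace_im (h : GoodX X K) (U) {B : Matrix ι ι ℂ} (hB : Bᴴ = B) :
    ((X U * B).trace).im = 0 := by
  have : star ((X U * B).trace) = (X U * B).trace := by
    rw [← Matrix.trace_conjTranspose, Matrix.conjTranspose_mul, h.herm, hB, Matrix.trace_mul_comm]
  exact Complex.conj_eq_iff_im.mp this

lemma GoodX.quad_diag (h : GoodX X K) {c : ℝ}
    (hc : ∀ a b, ∫ U, (X U a a).re * (X U b b).re ∂μ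
      = c * ((if a = b then 1 else 0) - 1 / (Fintype.card ι : ℝ))) (l : ι → ℝ) :
    ∫ U, ‖(X U * Matrix.diagonal (fun a => (l a : ℂ))).trace‖ ^ 2 ∂μ
      = c * (∑ a, l a ^ 2 - (∑ a, l a) ^ 2 / Fintype.card ι) := by
  have h1 : ∀ U, ‖(X U * Matrix.diagonal (fun a => (l a : ℂ))).trace‖ ^ 2
      = ∑ a, ∑ b, l a * l b * ((X U a a).re * (X U b b).re) := by
    intro U
    have : (X U * Matrix.diagonal (fun a => (l a : ℂ))).trace
        = ((∑ a, (X U a a).re * l a : ℝ) : ℂ) := by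
      simp only [Matrix.trace, Matrix.diag, Matrix.mul_diagonal]
      push_cast
      exact Finset.sum_congr rfl fun a _ => by rw [← h.diag_re]
    rw [this, Complex.norm_real, Real.norm_eq_abs, sq_abs, sq, Finset.sum_mul_sum]
    exact Finset.sum_congr rfl fun a _ => Finset.sum_congr rfl fun b _ => by ring
  have hi : ∀ a b, Integrable (fun U => l a * l b * ((X U a a).re * (X U b b).re)) μ := by
    intro a b
    apply integrable_of_cont
    have := h.contEntry a a
    have := h.contEntry b b
    fun_prop
  simp_rw [h1]
  rw [integral_finsetSum _ fun a _ => integrable_finsetSum _ fun b _ => hi a b]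
  simp_rw [integral_finsetSum _ fun b _ => hi _ b, integral_const_mul, hc]
  have : ∀ a b, l a * l b * (c * ((if a = b then 1 else 0) - 1 / (Fintype.card ι : ℝ)))
    = (if a = b then c * (l a * l b) else 0) - c / (Fintype.card ι : ℝ) * (l a * l b) := by
    intro a b; split_ifs <;> ring
  simp_rw [this, Finset.sum_sub_distrib, Finset.sum_ite_eq, ← Finset.mul_sum, ← Finset.sum_mul]
  simp only [Finset.mem_univ, if_true, ← Finset.mul_sum]
  simp_rw [← sq]
  ring

lemma GoodX.quad_herm (h : GoodX X K) {c : ℝ}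
    (hc : ∀ a b, ∫ U, (X U a a).re * (X U b b).re ∂μ
      = c * ((if a = b then 1 else 0) - 1 / (Fintype.card ι : ℝ)))
    {B : Matrix ι ι ℂ} (hB : Bᴴ = B) :
    ∫ U, ‖(X U * B).trace‖ ^ 2 ∂μ
      = c * ((Bᴴ * B).trace.re - B.trace.re ^ 2 / Fintype.card ι) := by
  have hH : B.IsHermitian := hB
  set W := hH.eigenvectorUnitary with hW
  set l := hH.eigenvalues with hl
  set D := Matrix.diagonal (fun a => (l a : ℂ)) with hD
  have hs : B = (W : Matrix ι ι ℂ) * D * (W : Matrix ι ι ℂ)ᴴ := by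
    have := hH.spectral_theorem
    rw [Unitary.conjStarAlgAut_apply] at this
    exact this
  have hWW : (W : Matrix ι ι ℂ)ᴴ * (W : Matrix ι ι ℂ) = 1 :=
    Matrix.mem_unitaryGroup_iff'.mp W.2
  have e1 : ∀ U, (X U * B).trace = (X (U * W) * D).trace := by
    intro U
    rw [h.equiv, hs, ← mul_assoc, Matrix.trace_mul_comm]
    simp only [mul_assoc]
  have e2 : (Bᴴ * B).trace.re = ∑ a, l a ^ 2 := by
    have : (Bᴴ * B).trace = (D * D).trace := by
      rw [hB, hs]
      rw [show (W : Matrix ι ι ℂ) * D * (W : Matrix ι ι ℂ)ᴴ * (W * D * (W : Matrix ι ι ℂ)ᴴ)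
        = W * D * ((W : Matrix ι ι ℂ)ᴴ * W) * D * (W : Matrix ι ι ℂ)ᴴ by simp only [mul_assoc],
        hWW, Matrix.trace_mul_comm, mul_one, ← mul_assoc, ← mul_assoc, hWW, one_mul]
    rw [this, hD, Matrix.diagonal_mul_diagonal, Matrix.trace_diagonal, Complex.re_sum]
    exact Finset.sum_congr rfl fun a _ => by
      rw [← Complex.ofReal_mul, Complex.ofReal_re]; ring
  have e3 : B.trace.re = ∑ a, l a := by
    have : B.trace = D.trace := by
      rw [hs, Matrix.trace_mul_comm, ← mul_assoc, hWW, one_mul]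
    rw [this, hD, Matrix.trace_diagonal, Complex.re_sum]
    simp
  simp_rw [e1]
  rw [integral_mul_right_eq_self (μ := μ) (fun U => ‖(X U * D).trace‖ ^ 2) W,
    h.quad_diag μ hc, e2, e3]

lemma norm_sq_add_I (x y : ℂ) (hx : x.im = 0) (hy : y.im = 0) :
    ‖x + Complex.I * y‖ ^ 2 = ‖x‖ ^ 2 + ‖y‖ ^ 2 := by
  rw [← Complex.normSq_eq_norm_sq, ← Complex.normSq_eq_norm_sq, ← Complex.normSq_eq_norm_sq]
  simp [Complex.normSq_apply, hx, hy]

lemma GoodX.quad (h : GoodX X K) {c : ℝ}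
    (hc : ∀ a b, ∫ U, (X U a a).re * (X U b b).re ∂μ
      = c * ((if a = b then 1 else 0) - 1 / (Fintype.card ι : ℝ)))
    (A : Matrix ι ι ℂ) :
    ∫ U, ‖(X U * A).trace‖ ^ 2 ∂μ
      = c * ((Aᴴ * A).trace.re - ‖A.trace‖ ^ 2 / Fintype.card ι) := by
  obtain ⟨B, C, hB, hC, hA⟩ : ∃ B C : Matrix ι ι ℂ, Bᴴ = B ∧ Cᴴ = C ∧ A = B + Complex.I • C :=
    ⟨realPart A, imaginaryPart A, (realPart A).2, (imaginaryPart A).2,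
      (realPart_add_I_smul_imaginaryPart A).symm⟩
  have him : ∀ {B : Matrix ι ι ℂ}, Bᴴ = B → B.trace.im = 0 := by
    intro B hB
    have : star B.trace = B.trace := by rw [← Matrix.trace_conjTranspose, hB]
    exact Complex.conj_eq_iff_im.mp this
  have hn : ∀ {B : Matrix ι ι ℂ}, Bᴴ = B → ‖B.trace‖ ^ 2 = B.trace.re ^ 2 := by
    intro B hB
    rw [← Complex.normSq_eq_norm_sq, Complex.normSq_apply, him hB]; ring
  have e1 : ∀ U, ‖(X U * A).trace‖ ^ 2 = ‖(X U * B).trace‖ ^ 2 + ‖(X U * C).trace‖ ^ 2 := by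
    intro U
    rw [← norm_sq_add_I _ _ (h.trace_im U hB) (h.trace_im U hC), hA]
    simp [mul_add]
  have e2 : ‖A.trace‖ ^ 2 = B.trace.re ^ 2 + C.trace.re ^ 2 := by
    rw [← hn hB, ← hn hC, ← norm_sq_add_I _ _ (him hB) (him hC), hA]
    simp
  have e3 : (Aᴴ * A).trace.re = (Bᴴ * B).trace.re + (Cᴴ * C).trace.re := by
    rw [hA]
    simp only [Matrix.conjTranspose_add, Matrix.conjTranspose_smul, hB, hC, add_mul, mul_add,
      Matrix.smul_mul, Matrix.mul_smul, Matrix.trace_add, Matrix.trace_smul, smul_smul,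
      Matrix.trace_mul_comm C B]
    simp
  have hi : ∀ B : Matrix ι ι ℂ, Integrable (fun U => ‖(X U * B).trace‖ ^ 2) μ := by
    intro B
    apply integrable_of_cont
    have := h.cont
    exact ((this.matrix_mul continuous_const).matrix_trace.norm).pow 2
  simp_rw [e1]
  rw [integral_add (hi B) (hi C), h.quad_herm μ hc hB, h.quad_herm μ hc hC, e2, e3]
  ring

lemma trace_conj_mul_self (A : Matrix ι ι ℂ) :
    (Aᴴ * A).trace.re = ∑ a, ∑ b, ‖A b a‖ ^ 2 := by
  simp only [Matrix.trace, Matrix.diag, Matrix.mul_apply, Complex.re_sum,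
    Matrix.conjTranspose_apply]
  refine Finset.sum_congr rfl fun a _ => Finset.sum_congr rfl fun b _ => ?_
  rw [← Complex.normSq_eq_norm_sq, Complex.normSq_apply]
  simp

lemma GoodX.main (h : GoodX X K) (hn : 2 ≤ Fintype.card ι) (A : Matrix ι ι ℂ) :
    ∫ U, ‖(X U * A).trace‖ ^ 2 ∂μ
      = K / ((Fintype.card ι : ℝ) ^ 2 - 1) *
        ((Aᴴ * A).trace.re - ‖A.trace‖ ^ 2 / Fintype.card ι) := by
  obtain ⟨c, hc⟩ := h.diag_cov μ hn
  have hn' : (2 : ℝ) ≤ Fintype.card ι := by exact_mod_cast hn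
  have hE : ∀ a b, ∫ U, ‖X U a b‖ ^ 2 ∂μ
      = c * (1 - (if a = b then 1 else 0) / Fintype.card ι) := by
    intro a b
    have := h.quad μ hc (Matrix.single b a 1)
    have e1 : ∀ U, (X U * Matrix.single b a 1).trace = X U a b := by
      intro U; simp [Matrix.trace_mul_single]
    simp_rw [e1] at this
    rw [this]
    congr 2
    · simp [Matrix.conjTranspose_single]
    · by_cases hab : a = b
      · subst hab; simp
      · simp [Matrix.trace_single_eq_of_ne _ _ _ (Ne.symm hab), hab]
  have hi : ∀ a b, Integrable (fun U => ‖X U a b‖ ^ 2) μ := by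
    intro a b
    exact integrable_of_cont μ (((h.contEntry a b).norm).pow 2)
  have hK : ∫ U, ∑ a, ∑ b, ‖X U a b‖ ^ 2 ∂μ = K := by
    simp [h.frob]
  rw [integral_finsetSum _ fun a _ => integrable_finsetSum _ fun b _ => hi a b] at hK
  simp_rw [integral_finsetSum _ fun b _ => hi _ b, hE, ← Finset.mul_sum, Finset.sum_sub_distrib,
    ← Finset.sum_div, Finset.sum_ite_eq] at hK
  simp at hK
  have hcK : c = K / ((Fintype.card ι : ℝ) ^ 2 - 1) := by
    rw [eq_div_iff (by nlinarith), ← hK]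
    field_simp
  rw [← hcK]
  exact h.quad μ hc A

end Helpers

section Concrete

variable (P d m : ℕ) (hP : 0 < P)

/-- the rank `d` projector -/
noncomputable def projM : Matrix (Fin P × Fin d) (Fin P × Fin d) ℂ :=
  Matrix.diagonal fun x => if x.1 = ⟨0, hP⟩ then 1 else 0

/-- the centred random matrix -/
noncomputable def devM (U : Matrix.unitaryGroup (Fin P × Fin d) ℂ) :
    Matrix (Fin P × Fin d) (Fin P × Fin d) ℂ :=
  (P : ℂ) • ((U : Matrix (Fin P × Fin d) (Fin P × Fin d) ℂ)ᴴ * projM P d hP *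
    (U : Matrix (Fin P × Fin d) (Fin P × Fin d) ℂ)) - 1

lemma projM_herm : (projM P d hP)ᴴ = projM P d hP := by
  unfold projM
  rw [Matrix.diagonal_conjTranspose]
  congr 1
  ext x
  simp [apply_ite]

lemma projM_sq : projM P d hP * projM P d hP = projM P d hP := by
  unfold projM
  rw [Matrix.diagonal_mul_diagonal]
  congr 1
  ext x
  simp

lemma projM_trace : (projM P d hP).trace = d := by
  unfold projM
  rw [Matrix.trace_diagonal, Fintype.sum_prod_type, Finset.sum_comm]
  simp

lemma devM_good : GoodX (devM P d hP) ((P : ℝ) * d * (P - 1)) := by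
  have htr : ∀ U : Matrix.unitaryGroup (Fin P × Fin d) ℂ,
      ((U : Matrix (Fin P × Fin d) (Fin P × Fin d) ℂ)ᴴ * projM P d hP *
        (U : Matrix (Fin P × Fin d) (Fin P × Fin d) ℂ)).trace = d := by
    intro U
    rw [mul_assoc, Matrix.trace_mul_comm, mul_assoc,
      show (U : Matrix (Fin P × Fin d) (Fin P × Fin d) ℂ) *
        (U : Matrix (Fin P × Fin d) (Fin P × Fin d) ℂ)ᴴ = 1 from
        Matrix.mem_unitaryGroup_iff.mp U.2, mul_one, projM_trace]
  have hherm : ∀ U, (devM P d hP U)ᴴ = devM P d hP U := by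
    intro U
    simp [devM, projM_herm, Matrix.conjTranspose_mul, mul_assoc]
  refine ⟨?_, ?_, hherm, ?_, ?_⟩
  · unfold devM
    fun_prop
  · intro U W
    have hW : (W : Matrix (Fin P × Fin d) (Fin P × Fin d) ℂ)ᴴ *
        (W : Matrix (Fin P × Fin d) (Fin P × Fin d) ℂ) = 1 :=
      Matrix.mem_unitaryGroup_iff'.mp W.2
    simp [devM, mul_sub, sub_mul, hW, Matrix.conjTranspose_mul, mul_assoc]
  · intro U
    unfold devM
    rw [Matrix.trace_sub, Matrix.trace_smul, htr]
    simp
  · intro U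
    rw [Finset.sum_comm, ← trace_conj_mul_self, hherm]
    set R := (U : Matrix (Fin P × Fin d) (Fin P × Fin d) ℂ)ᴴ * projM P d hP *
        (U : Matrix (Fin P × Fin d) (Fin P × Fin d) ℂ) with hR
    have hRR : R * R = R := by
      rw [hR, show (U : Matrix (Fin P × Fin d) (Fin P × Fin d) ℂ)ᴴ * projM P d hP *
        (U : Matrix (Fin P × Fin d) (Fin P × Fin d) ℂ) *
        ((U : Matrix (Fin P × Fin d) (Fin P × Fin d) ℂ)ᴴ * projM P d hP *
        (U : Matrix (Fin P × Fin d) (Fin P × Fin d) ℂ)) =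
        (U : Matrix (Fin P × Fin d) (Fin P × Fin d) ℂ)ᴴ * projM P d hP *
        ((U : Matrix (Fin P × Fin d) (Fin P × Fin d) ℂ) *
        (U : Matrix (Fin P × Fin d) (Fin P × Fin d) ℂ)ᴴ) * projM P d hP *
        (U : Matrix (Fin P × Fin d) (Fin P × Fin d) ℂ) by simp only [mul_assoc],
        show (U : Matrix (Fin P × Fin d) (Fin P × Fin d) ℂ) *
        (U : Matrix (Fin P × Fin d) (Fin P × Fin d) ℂ)ᴴ = 1 from
        Matrix.mem_unitaryGroup_iff.mp U.2, mul_one, mul_assoc _ (projM P d hP) (projM P d hP),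
        projM_sq]
    have hRt : R.trace = d := htr U
    have hdev : devM P d hP U = (P : ℂ) • R - 1 := rfl
    have : (devM P d hP U * devM P d hP U).trace = (((P : ℝ) * d * (P - 1) : ℝ) : ℂ) := by
      rw [hdev]
      simp only [sub_mul, mul_sub, Matrix.smul_mul, Matrix.mul_smul, hRR, one_mul, mul_one,
        Matrix.trace_sub, Matrix.trace_smul, hRt, Matrix.trace_one]
      simp [Fintype.card_prod]
      ring
    rw [this, Complex.ofReal_re]

/-- the rank-type matrix `A(x', x) = ∑ y, ψ₂(x', y) conj ψ₁(x, y)` -/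
noncomputable def pairM (ψ₁ ψ₂ : (Fin P × Fin d) × Fin m → ℂ) :
    Matrix (Fin P × Fin d) (Fin P × Fin d) ℂ :=
  fun x' x => ∑ y, ψ₂ (x', y) * conj (ψ₁ (x, y))

lemma inn_sub (U : Matrix.unitaryGroup (Fin P × Fin d) ℂ)
    (ψ₁ ψ₂ : (Fin P × Fin d) × Fin m → ℂ) :
    inn (sliceV P d m hP U ψ₁) (sliceV P d m hP U ψ₂) - inn ψ₁ ψ₂
      = (devM P d hP U * pairM P d m ψ₁ ψ₂).trace := by
  set V := (U : Matrix (Fin P × Fin d) (Fin P × Fin d) ℂ) with hV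
  have hsq : (Real.sqrt P : ℂ) * (Real.sqrt P : ℂ) = P := by
    rw [← Complex.ofReal_mul, Real.mul_self_sqrt (by positivity)]; simp
  have hent : ∀ x x', (Vᴴ * projM P d hP * V) x x'
      = ∑ j : Fin d, conj (V (⟨0, hP⟩, j) x) * V (⟨0, hP⟩, j) x' := by
    intro x x'
    rw [projM, Matrix.mul_apply]
    simp only [Matrix.mul_diagonal, Matrix.conjTranspose_apply]
    rw [Fintype.sum_prod_type, Finset.sum_comm]
    simp
  have h1 : inn (sliceV P d m hP U ψ₁) (sliceV P d m hP U ψ₂)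
      = ((P : ℂ) • (Vᴴ * projM P d hP * V) * pairM P d m ψ₁ ψ₂).trace := by
    rw [Matrix.smul_mul, Matrix.trace_smul]
    simp only [Matrix.trace, Matrix.diag, Matrix.mul_apply (M := Vᴴ * projM P d hP * V), hent,
      pairM, inn, sliceV, ← hV, map_mul, map_sum, Complex.conj_ofReal, smul_eq_mul,
      Fintype.sum_prod_type (α₁ := Fin d)]
    have : ∀ (j : Fin d) (y : Fin m),
      (Real.sqrt P : ℂ) * (∑ x, conj (V (⟨0, hP⟩, j) x) * conj (ψ₁ (x, y))) *
        ((Real.sqrt P : ℂ) * ∑ x, V (⟨0, hP⟩, j) x * ψ₂ (x, y))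
      = (P : ℂ) * ∑ x, ∑ x', conj (V (⟨0, hP⟩, j) x) * V (⟨0, hP⟩, j) x' *
          (ψ₂ (x', y) * conj (ψ₁ (x, y))) := by
      intro j y
      rw [mul_mul_mul_comm, hsq, Finset.sum_mul_sum]
      congr 1
      exact Finset.sum_congr rfl fun x _ => Finset.sum_congr rfl fun x' _ => by ring
    simp only [this, ← Finset.mul_sum]
    congr 1
    simp only [Finset.sum_mul_sum]
    rw [Finset.sum_congr rfl fun j _ => Finset.sum_comm, Finset.sum_comm]
    refine Finset.sum_congr rfl fun x _ => ?_
    rw [Finset.sum_congr rfl fun j _ => Finset.sum_comm, Finset.sum_comm]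
  have h2 : inn ψ₁ ψ₂ = ((1 : Matrix (Fin P × Fin d) (Fin P × Fin d) ℂ) *
      pairM P d m ψ₁ ψ₂).trace := by
    rw [one_mul]
    simp only [Matrix.trace, Matrix.diag, pairM, inn, Fintype.sum_prod_type (α₂ := Fin m)]
    exact Finset.sum_congr rfl fun x _ => Finset.sum_congr rfl fun x' _ => mul_comm _ _
  rw [h1, h2, devM, sub_mul, Matrix.trace_sub]

lemma inn_self {κ : Type*} [Fintype κ] (f : κ → ℂ) : inn f f = ((∑ x, ‖f x‖ ^ 2 : ℝ) : ℂ) := by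
  simp only [inn]
  push_cast
  exact Finset.sum_congr rfl fun x _ => by
    rw [← Complex.normSq_eq_conj_mul_self, Complex.normSq_eq_norm_sq]; simp

lemma pairM_frob (ψ₁ ψ₂ : (Fin P × Fin d) × Fin m → ℂ) (h1 : inn ψ₁ ψ₁ = 1)
    (h2 : inn ψ₂ ψ₂ = 1) :
    ((pairM P d m ψ₁ ψ₂)ᴴ * pairM P d m ψ₁ ψ₂).trace.re ≤ 1 := by
  rw [inn_self] at h1 h2
  have h1' : ∑ x, ‖ψ₁ x‖ ^ 2 = 1 := by exact_mod_cast h1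
  have h2' : ∑ x, ‖ψ₂ x‖ ^ 2 = 1 := by exact_mod_cast h2
  rw [Fintype.sum_prod_type] at h1' h2'
  rw [trace_conj_mul_self]
  calc _ ≤ ∑ a, ∑ b, (∑ y, ‖ψ₁ (a, y)‖ ^ 2) * (∑ y, ‖ψ₂ (b, y)‖ ^ 2) := by
        refine Finset.sum_le_sum fun a _ => Finset.sum_le_sum fun b _ => ?_
        have : ‖pairM P d m ψ₁ ψ₂ b a‖ ≤ ∑ y, ‖ψ₁ (a, y)‖ * ‖ψ₂ (b, y)‖ := by
          refine (norm_sum_le _ _).trans (Finset.sum_le_sum fun y _ => ?_)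
          simp [mul_comm]
        calc _ ≤ (∑ y, ‖ψ₁ (a, y)‖ * ‖ψ₂ (b, y)‖) ^ 2 := by gcongr
          _ ≤ _ := Finset.sum_mul_sq_le_sq_mul_sq _ _ _
    _ = 1 := by rw [← Finset.sum_mul_sum, h1', h2', one_mul]

lemma upper_bound (hP2 : 2 ≤ P) (hd : 1 ≤ d)
    (μ : Measure (Matrix.unitaryGroup (Fin P × Fin d) ℂ)) [IsProbabilityMeasure μ]
    [μ.IsMulRightInvariant]
    (ψ₁ ψ₂ : (Fin P × Fin d) × Fin m → ℂ) (h1 : inn ψ₁ ψ₁ = 1) (h2 : inn ψ₂ ψ₂ = 1) :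
    ∫ U, ‖inn (sliceV P d m hP U ψ₁) (sliceV P d m hP U ψ₂) - inn ψ₁ ψ₂‖ ^ 2 ∂μ ≤ 2 / d := by
  have hcard : 2 ≤ Fintype.card (Fin P × Fin d) := by
    simp only [Fintype.card_prod, Fintype.card_fin]; nlinarith
  simp_rw [inn_sub]
  rw [(devM_good P d hP).main μ hcard]
  have hP2' : (2 : ℝ) ≤ P := by exact_mod_cast hP2
  have hd' : (1 : ℝ) ≤ d := by exact_mod_cast hd
  have hf := pairM_frob P d m ψ₁ ψ₂ h1 h2
  simp only [Fintype.card_prod, Fintype.card_fin]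
  push_cast
  have hn : (2 : ℝ) ≤ P * d := by nlinarith
  have hq : 0 ≤ ‖(pairM P d m ψ₁ ψ₂).trace‖ ^ 2 / ((P : ℝ) * d) := by positivity
  have hc0 : 0 ≤ (P : ℝ) * d * (P - 1) / (((P : ℝ) * d) ^ 2 - 1) := by
    apply div_nonneg
    · have : (0 : ℝ) ≤ P - 1 := by linarith
      positivity
    · nlinarith
  have hc1 : (P : ℝ) * d * (P - 1) / (((P : ℝ) * d) ^ 2 - 1) ≤ 2 / d := by
    rw [div_le_div_iff₀ (by nlinarith) (by linarith)]
    nlinarith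
  calc _ ≤ (P : ℝ) * d * (P - 1) / (((P : ℝ) * d) ^ 2 - 1) * 1 := by
        apply mul_le_mul_of_nonneg_left _ hc0
        linarith
    _ ≤ _ := by rw [mul_one]; exact hc1

lemma lower_bound (hP2 : 2 ≤ P) (hd : 1 ≤ d) (hm : 1 ≤ m)
    (μ : Measure (Matrix.unitaryGroup (Fin P × Fin d) ℂ)) [IsProbabilityMeasure μ]
    [μ.IsMulRightInvariant] :
    ∃ ψ₁ ψ₂ : (Fin P × Fin d) × Fin m → ℂ, inn ψ₁ ψ₁ = 1 ∧ inn ψ₂ ψ₂ = 1 ∧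
    1 / (2 * d) ≤
      ∫ U, ‖inn (sliceV P d m hP U ψ₁) (sliceV P d m hP U ψ₂) - inn ψ₁ ψ₂‖ ^ 2 ∂μ := by
  have hcard : 2 ≤ Fintype.card (Fin P × Fin d) := by
    simp only [Fintype.card_prod, Fintype.card_fin]; nlinarith
  obtain ⟨a, b, hab⟩ := Fintype.one_lt_card_iff.mp hcard
  set y0 : Fin m := ⟨0, hm⟩
  refine ⟨Pi.single (a, y0) 1, Pi.single (b, y0) 1, ?_, ?_, ?_⟩
  · simp [inn, Pi.single_apply]
  · simp [inn, Pi.single_apply]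
  have hpair : pairM P d m (Pi.single (a, y0) 1) (Pi.single (b, y0) 1)
      = Matrix.single b a 1 := by
    ext x' x
    simp only [pairM, Pi.single_apply, Matrix.single_apply, Prod.mk.injEq]
    by_cases h1 : x' = b <;> by_cases h2 : x = a <;> simp [h1, h2, eq_comm (a := a), eq_comm (a := b)]
  simp_rw [inn_sub]
  rw [(devM_good P d hP).main μ hcard, hpair, Matrix.trace_single_eq_of_ne _ _ _ (Ne.symm hab)]
  have hP2' : (2 : ℝ) ≤ P := by exact_mod_cast hP2
  have hd' : (1 : ℝ) ≤ d := by exact_mod_cast hd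
  have hn : (2 : ℝ) ≤ P * d := by nlinarith
  simp only [Matrix.conjTranspose_single, Matrix.single_mul_single_same,
    Matrix.trace_single_eq_same, Fintype.card_prod, Fintype.card_fin]
  push_cast
  simp
  rw [← one_div, ← one_div, div_mul_div_comm, one_mul, div_le_div_iff₀ (by linarith) (by nlinarith)]
  nlinarith [mul_nonneg (show (0:ℝ) ≤ (P:ℝ) * d * d by positivity) (show (0:ℝ) ≤ P - 2 by linarith)]

end Concrete

/-- **Single-layer form of the observer theorem.**  Let `P, d, m, S : ℕ → ℕ` with
`P_N ≥ 2`, `d_N, m_N, S_N ≥ 1` and `min(N, S_N) → ∞`, and for each `N` let `μ_N` be the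
Haar probability measure (the left- and right-invariant Borel probability measure) on the
unitary group `U(P_N d_N)`.  The following are equivalent:
(a) for every `α > 0` there is `C` with
    `∫ |⟨ψ₁, V_N(U)†V_N(U) ψ₂⟩ − ⟨ψ₁, ψ₂⟩|² dμ_N(U) ≤ C·max(N^{−α}, S_N^{−α})` for all
    `N ≥ 1` and all unit vectors `ψ₁, ψ₂`;
(b) for every `k : ℕ`, `(min(N, S_N))^k / d_N → 0`. -/
theorem sliceV_observer_emergence_iff (P d m S : ℕ → ℕ)
    (hP : ∀ N, 2 ≤ P N) (hd : ∀ N, 1 ≤ d N) (hm : ∀ N, 1 ≤ m N) (hS : ∀ N, 1 ≤ S N)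
    (hmin : Filter.Tendsto (fun N : ℕ => min N (S N)) Filter.atTop Filter.atTop)
    (μ : ∀ N, Measure (Matrix.unitaryGroup (Fin (P N) × Fin (d N)) ℂ))
    (hprob : ∀ N, IsProbabilityMeasure (μ N))
    (hleft : ∀ N, (μ N).IsMulLeftInvariant)
    (hright : ∀ N, (μ N).IsMulRightInvariant) :
    (∀ α : ℝ, 0 < α → ∃ C : ℝ, ∀ N : ℕ, 1 ≤ N →
        ∀ ψ₁ ψ₂ : (Fin (P N) × Fin (d N)) × Fin (m N) → ℂ,
          inn ψ₁ ψ₁ = 1 → inn ψ₂ ψ₂ = 1 →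
          ∫ U, ‖inn (sliceV (P N) (d N) (m N) (lt_of_lt_of_le two_pos (hP N)) U ψ₁)
                    (sliceV (P N) (d N) (m N) (lt_of_lt_of_le two_pos (hP N)) U ψ₂)
                  - inn ψ₁ ψ₂‖ ^ 2 ∂(μ N)
            ≤ C * max ((N : ℝ) ^ (-α)) ((S N : ℝ) ^ (-α)))
      ↔ (∀ k : ℕ, Filter.Tendsto (fun N : ℕ => (min N (S N) : ℝ) ^ k / (d N : ℝ))
          Filter.atTop (nhds 0)) := by
  have hmax : ∀ (N : ℕ) (α : ℝ), 1 ≤ N → 0 < α →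
      max ((N : ℝ) ^ (-α)) ((S N : ℝ) ^ (-α)) = (min (N : ℝ) (S N : ℝ)) ^ (-α) := by
    intro N α hN hα
    have h1 : (0 : ℝ) < N := by exact_mod_cast hN
    have h2 : (0 : ℝ) < S N := by exact_mod_cast hS N
    rcases le_total (N : ℝ) (S N : ℝ) with h | h
    · rw [min_eq_left h, max_eq_left]
      exact Real.rpow_le_rpow_of_nonpos h1 h (by linarith)
    · rw [min_eq_right h, max_eq_right]
      exact Real.rpow_le_rpow_of_nonpos h2 h (by linarith)
  have hM1 : ∀ N : ℕ, 1 ≤ N → (1 : ℝ) ≤ min (N : ℝ) (S N : ℝ) := by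
    intro N hN
    exact le_min (by exact_mod_cast hN) (by exact_mod_cast hS N)
  have hMt : Filter.Tendsto (fun N : ℕ => min (N : ℝ) (S N : ℝ)) Filter.atTop Filter.atTop := by
    have := (tendsto_natCast_atTop_atTop (R := ℝ)).comp hmin
    refine this.congr fun N => ?_
    simp
  constructor
  · intro h k
    obtain ⟨C, hC⟩ := h (k + 1) (by positivity)
    have ht : Filter.Tendsto (fun N : ℕ => 2 * C / min (N : ℝ) (S N : ℝ)) Filter.atTop (nhds 0) :=
      hMt.const_div_atTop (2 * C)
    refine squeeze_zero' (Filter.Eventually.of_forall fun N => by positivity) ?_ ht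
    filter_upwards [Filter.eventually_ge_atTop 1] with N hN
    have := hprob N
    have := hright N
    obtain ⟨ψ₁, ψ₂, h1, h2, h3⟩ := lower_bound (P N) (d N) (m N)
      (lt_of_lt_of_le two_pos (hP N)) (hP N) (hd N) (hm N) (μ N)
    have h4 := h3.trans (hC N hN ψ₁ ψ₂ h1 h2)
    rw [hmax N _ hN (by positivity)] at h4
    have hM := hM1 N hN
    set M := min (N : ℝ) (S N : ℝ) with hMdef
    have hM0 : 0 < M := by linarith
    have hdp : (0 : ℝ) < d N := by exact_mod_cast hd N
    have h5 : M ^ (-((k : ℝ) + 1)) = 1 / M ^ (k + 1) := by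
      rw [Real.rpow_neg hM0.le, one_div]
      congr 1
      exact_mod_cast Real.rpow_natCast M (k + 1)
    rw [h5, mul_one_div, div_le_div_iff₀ (by positivity) (by positivity)] at h4
    rw [div_le_div_iff₀ hdp hM0]
    rw [pow_succ] at h4
    linarith
  · intro h α hα
    obtain ⟨B, hB⟩ := (h ⌈α⌉₊).bddAbove_range
    refine ⟨2 * B, fun N hN ψ₁ ψ₂ h1 h2 => ?_⟩
    have := hprob N
    have := hright N
    refine (upper_bound (P N) (d N) (m N)
      (lt_of_lt_of_le two_pos (hP N)) (hP N) (hd N) (μ N) ψ₁ ψ₂ h1 h2).trans ?_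
    rw [hmax N α hN hα]
    have hBN : (min (N : ℝ) (S N : ℝ)) ^ ⌈α⌉₊ / (d N : ℝ) ≤ B := hB ⟨N, rfl⟩
    have hM := hM1 N hN
    set M := min (N : ℝ) (S N : ℝ) with hMdef
    have hM0 : 0 < M := by linarith
    have hdp : (0 : ℝ) < d N := by exact_mod_cast hd N
    have h6 : M ^ α ≤ M ^ ⌈α⌉₊ := by
      rw [← Real.rpow_natCast]
      exact Real.rpow_le_rpow_of_exponent_le hM (Nat.le_ceil α)
    have h7 : 0 < M ^ α := Real.rpow_pos_of_pos hM0 α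
    rw [Real.rpow_neg hM0.le, ← div_eq_mul_inv, div_le_div_iff₀ hdp h7]
    rw [div_le_iff₀ hdp] at hBN
    linarith
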